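/- In the setting of the two interleaved grids for q = k/m ∈ [1,2) in lowest terms (with 𝒯 = 𝒯_s ∪ 𝒯_t the ascending enumeration {τ_ℓ} of all grid points in (nmh, (n+1)mh], τ₀ := t_{nm}, τ̂_ℓ := (τ_{ℓ−1} + τ_ℓ)/2, Λ₁ := {τ_ℓ ∈ 𝒯_s : τ_{ℓ−1} ∈ 𝒯_s}, and ΔY := Y^h − Y^{h/q}), there exists a constant C, independent of ℓ, n and h, such that for every τ_ℓ ∈ 𝒯 with τ_{ℓ+1} ∉ Λ₁ one has |ΔY_{τ̂_{ℓ+1}}| ≤ C ( |ΔY_{τ̂_{ℓ−1}}| · 1_{τ_ℓ ∈ Λ₁} + |ΔY_{τ̂_ℓ}| · 1_{τ_ℓ ∉ Λ₁} + h^{2α} ). -/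

import Mathlib

open scoped Classical

noncomputable section

/-- The setting of the paper: a time horizon `T`, a Hölder exponent `α ∈ (1/3, 1/2]`,
a regularity parameter `γ` with `1/α < γ ≤ 3`, an `α`-Hölder driver `X` (with Hölder
constant `CX`), a coefficient `f ∈ C^{γ-1}_b` (bounded, with bounded derivative `Df`
which is globally `(γ-2)`-Hölder; all bounds collected in the constant `M`), and a
second-order datum `Z` vanishing on the diagonal and satisfying the analytic
conditions (1), (2) and the algebraic (Chen-type) condition (3) with constant `CZ`. -/
structure RoughSetting (d : ℕ) where
  T : ℝ
  α : ℝ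
  γ : ℝ
  CX : ℝ
  CZ : ℝ
  M : ℝ
  X : ℝ → EuclideanSpace ℝ (Fin d)
  f : EuclideanSpace ℝ (Fin d) → EuclideanSpace ℝ (Fin d) →L[ℝ] EuclideanSpace ℝ (Fin d)
  Df : EuclideanSpace ℝ (Fin d) →
    EuclideanSpace ℝ (Fin d) →L[ℝ] EuclideanSpace ℝ (Fin d) →L[ℝ] EuclideanSpace ℝ (Fin d)
  Z : EuclideanSpace ℝ (Fin d) → ℝ → ℝ → EuclideanSpace ℝ (Fin d)
  hd : 0 < d
  hT : 0 < T
  hα₁ : 1 / 3 < α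
  hα₂ : α ≤ 1 / 2
  hγ₁ : 1 / α < γ
  hγ₂ : γ ≤ 3
  hf_bdd : ∀ x, ‖f x‖ ≤ M
  hf_deriv : ∀ x, HasFDerivAt f (Df x) x
  hDf_bdd : ∀ x, ‖Df x‖ ≤ M
  hDf_holder : ∀ x y, ‖Df x - Df y‖ ≤ M * ‖x - y‖ ^ (γ - 2)
  hX : ∀ s t : ℝ, ‖X t - X s‖ ≤ CX * |t - s| ^ α
  hZ_diag : ∀ x t, Z x t t = 0
  hZ1 : ∀ x, ∀ s t : ℝ, s ≤ t → ‖Z x s t‖ ≤ CZ * (t - s) ^ (2 * α)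
  hZ2 : ∀ x y, ∀ s t : ℝ, s ≤ t →
    ‖Z x s t - Z y s t‖ ≤ CZ * ‖x - y‖ ^ (γ - 2) * (t - s) ^ (2 * α)
  hZ3 : ∀ x, ∀ s u t : ℝ, s ≤ u → u ≤ t →
    ‖Z x s t - Z x s u - Z x u t -
        (Df x (f x (X u - X s)) (X t - X u) + Df x (Z x s u) (X t - X u))‖ ≤
      CZ * (t - s) ^ (3 * α)

/-- `Y` is the splitting-scheme approximation with step size `h` and initial datum
`Ybar`: on the grid `t_j = j h`, the first split equation (driven by `X`) is run at
twice the speed on `(t_j, t_j + h/2]`, and the second split equation (driven by `Z`)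
is run at twice the speed on `(t_j + h/2, t_{j+1}]`. -/
def RoughSetting.IsScheme {d : ℕ} (S : RoughSetting d) (h : ℝ)
    (Ybar : EuclideanSpace ℝ (Fin d)) (Y : ℝ → EuclideanSpace ℝ (Fin d)) : Prop :=
  Y 0 = Ybar ∧
    ∀ j : ℕ, ∀ t : ℝ,
      (t ∈ Set.Ioc ((j : ℝ) * h) ((j : ℝ) * h + h / 2) →
        Y t = Y ((j : ℝ) * h) +
          S.f (Y ((j : ℝ) * h))
            (S.X ((j : ℝ) * h + 2 * (t - (j : ℝ) * h)) - S.X ((j : ℝ) * h))) ∧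
      (t ∈ Set.Ioc ((j : ℝ) * h + h / 2) ((j : ℝ) * h + h) →
        Y t = Y ((j : ℝ) * h + h / 2) +
          S.Z (Y ((j : ℝ) * h + h / 2)) ((j : ℝ) * h)
            ((j : ℝ) * h + 2 * (t - ((j : ℝ) * h + h / 2))))

/-- The part of the fine grid `s_j = j · (h/q)` lying strictly between `nmh` and
`(n+1)mh` (endpoint removed): `𝒯_s = {s_{nk+j} : 1 ≤ j ≤ k−1}`, where `q = k/m`
in lowest terms and `hq = h/q = h·m/k`. -/
def gridTs (k n : ℕ) (hq : ℝ) : Finset ℝ :=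
  (Finset.Icc 1 (k - 1)).image fun j => ((n * k + j : ℕ) : ℝ) * hq

/-- The part of the coarse grid `t_j = j·h` lying in `(nmh, (n+1)mh]`:
`𝒯_t = {t_{nm+j} : 1 ≤ j ≤ m}`. -/
def gridTt (m n : ℕ) (h : ℝ) : Finset ℝ :=
  (Finset.Icc 1 m).image fun j => ((n * m + j : ℕ) : ℝ) * h

namespace RoughSetting

variable {d : ℕ} (S : RoughSetting d)

lemma M_nonneg : 0 ≤ S.M := (norm_nonneg _).trans (S.hf_bdd 0)

lemma norm_f_sub_le (x y : EuclideanSpace ℝ (Fin d)) : ‖S.f x - S.f y‖ ≤ S.M * ‖x - y‖ :=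
  convex_univ.norm_image_sub_le_of_norm_hasFDerivWithin_le
    (fun x _ => (S.hf_deriv x).hasFDerivWithinAt) (fun x _ => S.hDf_bdd x)
    (Set.mem_univ y) (Set.mem_univ x)

lemma norm_f_sub_le_two_mul (x y : EuclideanSpace ℝ (Fin d)) : ‖S.f x - S.f y‖ ≤ 2 * S.M := by
  linarith [norm_sub_le (S.f x) (S.f y), S.hf_bdd x, S.hf_bdd y]

lemma α_pos : 0 < S.α := by linarith [S.hα₁]

lemma rpow_two_mul_α {h : ℝ} (hh : 0 < h) : h ^ (2 * S.α) = h ^ S.α * h ^ S.α := by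
  rw [two_mul, Real.rpow_add hh]

/-- The state `y'` at driver time `u'` is an Euler step from the state `y` at driver time `u`,
up to an error of order `h ^ (2α)`. -/
def EulerRel (h C : ℝ) (y : EuclideanSpace ℝ (Fin d)) (u : ℝ) (y' : EuclideanSpace ℝ (Fin d))
    (u' : ℝ) : Prop :=
  ‖y' - y - S.f y (S.X u' - S.X u)‖ ≤ C * h ^ (2 * S.α) ∧ ‖S.X u' - S.X u‖ ≤ C * h ^ S.α

variable {S}

namespace EulerRel

variable {h C C' u u' u'' : ℝ} {y y' y'' z z' : EuclideanSpace ℝ (Fin d)}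

lemma nonneg (hh : 0 < h) (H : S.EulerRel h C y u y' u') : 0 ≤ C :=
  nonneg_of_mul_nonneg_left ((norm_nonneg _).trans H.2) (Real.rpow_pos_of_pos hh _)

lemma norm_f_sub_le (hh : 0 < h) (H : S.EulerRel h C y u y' u') :
    ‖S.f y' - S.f y‖ ≤ (S.M * (C + S.M * C) + 2 * S.M) * h ^ S.α := by
  have hM := S.M_nonneg
  have hC := H.nonneg hh
  have hp : 0 < h ^ S.α := Real.rpow_pos_of_pos hh _
  have hMC : 0 ≤ S.M * (C + S.M * C) := by positivity
  obtain h1 | h1 := le_total (h ^ S.α) 1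
  · have hf : ‖S.f y (S.X u' - S.X u)‖ ≤ S.M * (C * h ^ S.α) :=
      (S.f y).le_of_opNorm_le_of_le (S.hf_bdd y) H.2
    have hy : ‖y' - y‖ ≤ (C + S.M * C) * h ^ S.α := by
      have h2 : h ^ (2 * S.α) ≤ h ^ S.α := by
        rw [S.rpow_two_mul_α hh]; nlinarith
      have h3 := norm_add_le (y' - y - S.f y (S.X u' - S.X u)) (S.f y (S.X u' - S.X u))
      rw [sub_add_cancel] at h3
      have h4 := mul_le_mul_of_nonneg_left h2 hC
      linarith [H.1]
    have h5 := mul_le_mul_of_nonneg_left hy hM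
    have h6 := S.norm_f_sub_le y' y
    nlinarith [mul_nonneg hM hp.le]
  · have h6 := S.norm_f_sub_le_two_mul y' y
    nlinarith [mul_nonneg hMC hp.le]

lemma norm_f_sub_apply_le (hh : 0 < h) (H : S.EulerRel h C y u y' u')
    {v : EuclideanSpace ℝ (Fin d)} (hv : ‖v‖ ≤ C' * h ^ S.α) :
    ‖(S.f y' - S.f y) v‖ ≤ (S.M * (C + S.M * C) + 2 * S.M) * C' * h ^ (2 * S.α) := by
  refine ((S.f y' - S.f y).le_of_opNorm_le_of_le (H.norm_f_sub_le hh) hv).trans (le_of_eq ?_)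
  rw [S.rpow_two_mul_α hh]
  ring

lemma symm (hh : 0 < h) (H : S.EulerRel h C y u y' u') :
    S.EulerRel h (C + (S.M * (C + S.M * C) + 2 * S.M) * C) y' u' y u := by
  have hM := S.M_nonneg
  have hC := H.nonneg hh
  refine ⟨?_, ?_⟩
  · have h1 := H.norm_f_sub_apply_le hh H.2
    have h2 : y - y' - S.f y' (S.X u - S.X u') =
        (S.f y' - S.f y) (S.X u' - S.X u) - (y' - y - S.f y (S.X u' - S.X u)) := by
      simp only [sub_apply, map_sub]
      abel
    rw [h2]
    linarith [norm_sub_le ((S.f y' - S.f y) (S.X u' - S.X u))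
      (y' - y - S.f y (S.X u' - S.X u)), H.1]
  · rw [norm_sub_rev]
    refine H.2.trans (mul_le_mul_of_nonneg_right ?_ (Real.rpow_nonneg hh.le _))
    have : 0 ≤ (S.M * (C + S.M * C) + 2 * S.M) * C := by positivity
    linarith

lemma trans (hh : 0 < h) (H : S.EulerRel h C y u y' u') (H' : S.EulerRel h C' y' u' y'' u'') :
    S.EulerRel h (C + C' + (S.M * (C + S.M * C) + 2 * S.M) * C') y u y'' u'' := by
  have hM := S.M_nonneg
  have hC := H.nonneg hh
  have hC' := H'.nonneg hh
  refine ⟨?_, ?_⟩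
  · have h1 := H.norm_f_sub_apply_le hh H'.2
    have h2 : y'' - y - S.f y (S.X u'' - S.X u) =
        (y' - y - S.f y (S.X u' - S.X u)) + (y'' - y' - S.f y' (S.X u'' - S.X u')) +
          (S.f y' - S.f y) (S.X u'' - S.X u') := by
      simp only [sub_apply, map_sub]
      abel
    rw [h2]
    linarith [norm_add₃_le (a := y' - y - S.f y (S.X u' - S.X u))
      (b := y'' - y' - S.f y' (S.X u'' - S.X u')) (c := (S.f y' - S.f y) (S.X u'' - S.X u')),
      H.1, H'.1]
  · have h1 := norm_add_le (S.X u' - S.X u) (S.X u'' - S.X u')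
    rw [sub_add_sub_comm, add_comm (S.X u'), add_sub_add_right_eq_sub] at h1
    have h2 : 0 ≤ (S.M * (C + S.M * C) + 2 * S.M) * C' * h ^ S.α := by
      have := Real.rpow_nonneg hh.le S.α
      positivity
    linarith [H.2, H'.2]

lemma norm_sub_le (hh : 0 < h) (H : S.EulerRel h C y u y' u') (H' : S.EulerRel h C z u z' u') :
    ‖y' - z'‖ ≤ (1 + 2 * C + 2 * S.M * C) * (‖y - z‖ + h ^ (2 * S.α)) := by
  have hM := S.M_nonneg
  have hC := H.nonneg hh
  have hp : 0 < h ^ S.α := Real.rpow_pos_of_pos hh _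
  have hMC : 0 ≤ S.M * C := by positivity
  have hf : ‖(S.f y - S.f z) (S.X u' - S.X u)‖ ≤
      S.M * C * ‖y - z‖ + 2 * S.M * C * h ^ (2 * S.α) := by
    rw [S.rpow_two_mul_α hh]
    obtain h1 | h1 := le_total (h ^ S.α) 1
    · have h2 := (S.f y - S.f z).le_of_opNorm_le_of_le (S.norm_f_sub_le y z) H.2
      have h3 : S.M * ‖y - z‖ * (C * h ^ S.α) ≤ S.M * C * ‖y - z‖ := by
        have : 0 ≤ S.M * C * ‖y - z‖ := by positivity
        nlinarith
      have : 0 ≤ 2 * S.M * C * (h ^ S.α * h ^ S.α) := by positivity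
      linarith
    · have h2 := (S.f y - S.f z).le_of_opNorm_le_of_le (S.norm_f_sub_le_two_mul y z) H.2
      have h3 : 0 ≤ S.M * C * ‖y - z‖ := by positivity
      nlinarith [mul_nonneg hMC (mul_nonneg hp.le (sub_nonneg.2 h1))]
  have h2 : y' - z' = (y - z) + ((y' - y - S.f y (S.X u' - S.X u)) -
      (z' - z - S.f z (S.X u' - S.X u))) + (S.f y - S.f z) (S.X u' - S.X u) := by
    simp only [sub_apply, map_sub]
    abel
  have h3 := norm_add₃_le (a := y - z) (b := (y' - y - S.f y (S.X u' - S.X u)) -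
      (z' - z - S.f z (S.X u' - S.X u))) (c := (S.f y - S.f z) (S.X u' - S.X u))
  rw [← h2] at h3
  have h4 := _root_.norm_sub_le (y' - y - S.f y (S.X u' - S.X u))
    (z' - z - S.f z (S.X u' - S.X u))
  have h5 : 0 ≤ (2 * C + S.M * C) * ‖y - z‖ := by positivity
  have h6 : 0 ≤ h ^ (2 * S.α) := Real.rpow_nonneg hh.le _
  nlinarith [H.1, H'.1]

end EulerRel

/-- The subinterval `[a, b]` of the cell `[jη, (j+1)η]` shares at least one endpoint with it. -/
def TouchesCell (η : ℝ) (j : ℕ) (a b : ℝ) : Prop :=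
  (a = j * η ∧ a < b ∧ b ≤ j * η + η) ∨ (b = j * η + η ∧ j * η ≤ a ∧ a ≤ b)

lemma IsScheme.eulerRel_midpoint {h η : ℝ} {Ybar : EuclideanSpace ℝ (Fin d)}
    {Y : ℝ → EuclideanSpace ℝ (Fin d)} (hη : 0 < η) (hηh : η ≤ h) (hY : S.IsScheme η Ybar Y)
    {j : ℕ} {a b : ℝ} (hab : TouchesCell η j a b) :
    S.EulerRel h (|S.CX| + |S.CZ|) (Y (j * η)) (j * η) (Y ((a + b) / 2)) b := by
  have hh : 0 < h := hη.trans_le hηh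
  have hp : 0 < h ^ S.α := Real.rpow_pos_of_pos hh _
  have hp2 : 0 < h ^ (2 * S.α) := Real.rpow_pos_of_pos hh _
  have hCX := abs_nonneg S.CX
  have hCZ := abs_nonneg S.CZ
  have hb : (j : ℝ) * η ≤ b ∧ b ≤ j * η + η := by
    rcases hab with ⟨h1, h2, h3⟩ | ⟨h1, h2, h3⟩ <;> constructor <;> linarith
  have hX : ‖S.X b - S.X (j * η)‖ ≤ (|S.CX| + |S.CZ|) * h ^ S.α := by
    have h1 : |b - j * η| ^ S.α ≤ h ^ S.α := by
      refine Real.rpow_le_rpow (abs_nonneg _) ?_ S.α_pos.le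
      rw [abs_of_nonneg] <;> linarith
    calc ‖S.X b - S.X (j * η)‖ ≤ S.CX * |b - j * η| ^ S.α := S.hX _ _
      _ ≤ (|S.CX| + |S.CZ|) * h ^ S.α := by
        refine mul_le_mul ?_ h1 (Real.rpow_nonneg (abs_nonneg _) _) (by positivity)
        linarith [le_abs_self S.CX]
  refine ⟨?_, hX⟩
  by_cases hfirst : a = j * η ∧ a < b
  · obtain ⟨h1, h2⟩ := hfirst
    have h3 := (hY.2 j ((a + b) / 2)).1 ⟨by linarith, by linarith⟩
    have h4 : (j : ℝ) * η + 2 * ((a + b) / 2 - j * η) = b := by rw [h1]; ring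
    rw [h4] at h3
    rw [h3, add_sub_cancel_left, sub_self, norm_zero]
    positivity
  · obtain ⟨h1, h2, h3⟩ : b = j * η + η ∧ j * η < a ∧ a ≤ b := by
      rcases hab with ⟨h1, h2, -⟩ | ⟨h1, h2, h3⟩
      · exact absurd ⟨h1, h2⟩ hfirst
      · refine ⟨h1, lt_of_le_of_ne h2 fun h4 => hfirst ⟨h4.symm, by linarith⟩, h3⟩
    have h4 := (hY.2 j (j * η + η / 2)).1 ⟨by linarith, le_rfl⟩
    have h5 := (hY.2 j ((a + b) / 2)).2 ⟨by linarith, by linarith⟩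
    have h6 : (j : ℝ) * η + 2 * (j * η + η / 2 - j * η) = b := by rw [h1]; ring
    rw [h6] at h4
    rw [h5, add_sub_right_comm, h4, add_sub_cancel_left, add_sub_cancel_left]
    refine (S.hZ1 _ _ _ (by linarith)).trans ?_
    refine mul_le_mul ?_ (Real.rpow_le_rpow (by linarith) (by linarith) ?_)
      (Real.rpow_nonneg (by linarith) _) (by positivity)
    · linarith [le_abs_self S.CZ]
    · linarith [S.α_pos]

lemma IsScheme.eulerRel_succ {h η : ℝ} {Ybar : EuclideanSpace ℝ (Fin d)}
    {Y : ℝ → EuclideanSpace ℝ (Fin d)} (hη : 0 < η) (hηh : η ≤ h) (hY : S.IsScheme η Ybar Y)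
    (j : ℕ) : S.EulerRel h (|S.CX| + |S.CZ|) (Y (j * η)) (j * η)
      (Y ((j + 1 : ℕ) * η)) ((j + 1 : ℕ) * η) := by
  have h1 : ((j + 1 : ℕ) : ℝ) * η = j * η + η := by push_cast; ring
  have h2 : TouchesCell η j (((j + 1 : ℕ) : ℝ) * η) (((j + 1 : ℕ) : ℝ) * η) :=
    Or.inr ⟨h1, by linarith, le_rfl⟩
  simpa only [add_self_div_two] using hY.eulerRel_midpoint hη hηh h2

lemma EulerRel.mono {h C C' u u' : ℝ} {y y' : EuclideanSpace ℝ (Fin d)} (hh : 0 < h)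
    (hC : C ≤ C') (H : S.EulerRel h C y u y' u') : S.EulerRel h C' y u y' u' :=
  ⟨H.1.trans (mul_le_mul_of_nonneg_right hC (Real.rpow_nonneg hh.le _)),
    H.2.trans (mul_le_mul_of_nonneg_right hC (Real.rpow_nonneg hh.le _))⟩

variable (S) in
lemma exists_eulerRel_of_touchesCell : ∃ K : ℝ, ∀ h η : ℝ, 0 < η → η ≤ h →
    ∀ (Ybar : EuclideanSpace ℝ (Fin d)) (Y : ℝ → EuclideanSpace ℝ (Fin d)), S.IsScheme η Ybar Y →
      ∀ (j j' : ℕ) (a b a' b' : ℝ), j ≤ j' → j' ≤ j + 2 → TouchesCell η j a b →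
        TouchesCell η j' a' b' →
          S.EulerRel h K (Y ((a + b) / 2)) b (Y ((a' + b') / 2)) b' := by
  let P : ℕ → Prop := fun i => ∃ K : ℝ, ∀ h η : ℝ, 0 < η → η ≤ h →
    ∀ (Ybar : EuclideanSpace ℝ (Fin d)) (Y : ℝ → EuclideanSpace ℝ (Fin d)), S.IsScheme η Ybar Y →
      ∀ (j : ℕ) (a b : ℝ), TouchesCell η j a b →
        S.EulerRel h K (Y ((a + b) / 2)) b (Y ((j + i : ℕ) * η)) ((j + i : ℕ) * η)
  have hP : ∀ i, P i := by
    intro i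
    induction i with
    | zero =>
      exact ⟨_, fun h η hη hηh Ybar Y hY j a b hab =>
        (hY.eulerRel_midpoint hη hηh hab).symm (hη.trans_le hηh)⟩
    | succ i ih =>
      obtain ⟨K, hK⟩ := ih
      exact ⟨_, fun h η hη hηh Ybar Y hY j a b hab =>
        (hK h η hη hηh Ybar Y hY j a b hab).trans (hη.trans_le hηh)
          (hY.eulerRel_succ hη hηh (j + i))⟩
  have hQ : ∀ i, ∃ K : ℝ, ∀ h η : ℝ, 0 < η → η ≤ h →
      ∀ (Ybar : EuclideanSpace ℝ (Fin d)) (Y : ℝ → EuclideanSpace ℝ (Fin d)),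
        S.IsScheme η Ybar Y → ∀ (j : ℕ) (a b a' b' : ℝ), TouchesCell η j a b →
          TouchesCell η (j + i) a' b' →
            S.EulerRel h K (Y ((a + b) / 2)) b (Y ((a' + b') / 2)) b' := by
    intro i
    obtain ⟨K, hK⟩ := hP i
    exact ⟨_, fun h η hη hηh Ybar Y hY j a b a' b' hab hab' =>
      (hK h η hη hηh Ybar Y hY j a b hab).trans (hη.trans_le hηh)
        (hY.eulerRel_midpoint hη hηh hab')⟩
  choose K hK using hQ
  refine ⟨max (K 0) (max (K 1) (K 2)), ?_⟩
  intro h η hη hηh Ybar Y hY j j' a b a' b' h1 h2 hab hab'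
  obtain ⟨i, rfl⟩ := Nat.exists_eq_add_of_le h1
  refine (hK i h η hη hηh Ybar Y hY j a b a' b' hab hab').mono (hη.trans_le hηh) ?_
  obtain rfl | rfl | rfl : i = 0 ∨ i = 1 ∨ i = 2 := by omega
  · exact le_max_left _ _
  · exact (le_max_left _ _).trans (le_max_right _ _)
  · exact (le_max_right _ _).trans (le_max_right _ _)

end RoughSetting

lemma le_of_forall_lt_succ {τ : ℕ → ℝ} {N : ℕ} (hτ : ∀ l, l + 1 ≤ N → τ l < τ (l + 1)) {i j : ℕ}
    (hij : i ≤ j) (hj : j ≤ N) : τ i ≤ τ j := by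
  induction j, hij using Nat.le_induction with
  | base => exact le_rfl
  | succ j _ ih => exact (ih (by omega)).trans (hτ j hj).le

lemma exists_cell {τ : ℕ → ℝ} {N : ℕ} (hτ : ∀ l, l + 1 ≤ N → τ l < τ (l + 1)) {η : ℝ}
    (hη : 0 < η) {a b : ℕ} (h0 : τ 0 = a * η) (hN : ∀ l, l ≤ N → τ l ≤ b * η)
    (hmem : ∀ i, a < i → i ≤ b → ∃ l, l ≤ N ∧ τ l = i * η) {l : ℕ} (hl : l + 1 ≤ N) :
    ∃ j : ℕ, j * η ≤ τ l ∧ τ l < j * η + η ∧ τ (l + 1) ≤ j * η + η := by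
  have ha : (a : ℝ) * η ≤ τ l := h0 ▸ le_of_forall_lt_succ hτ (Nat.zero_le l) (by omega)
  have hb : τ l < b * η := (hτ l hl).trans_le (hN _ hl)
  have hnn : 0 ≤ τ l / η := div_nonneg (le_trans (by positivity) ha) hη.le
  have h1 : (⌊τ l / η⌋₊ : ℝ) * η ≤ τ l := (le_div_iff₀ hη).1 (Nat.floor_le hnn)
  have h2 : τ l < (⌊τ l / η⌋₊ + 1 : ℝ) * η := (div_lt_iff₀ hη).1 (Nat.lt_floor_add_one _)
  refine ⟨⌊τ l / η⌋₊, h1, by linarith, ?_⟩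
  obtain ⟨i, hi, hi'⟩ := hmem (⌊τ l / η⌋₊ + 1)
    (by
      have : (a : ℝ) < ((⌊τ l / η⌋₊ + 1 : ℕ) : ℝ) := by
        push_cast
        exact lt_of_mul_lt_mul_right (ha.trans_lt h2) hη.le
      exact_mod_cast this)
    (by
      have : (⌊τ l / η⌋₊ : ℝ) < (b : ℝ) := lt_of_mul_lt_mul_right (h1.trans_lt hb) hη.le
      exact_mod_cast this)
  push_cast at hi'
  have hli : l < i := by
    by_contra! hcon
    linarith [le_of_forall_lt_succ hτ hcon (by omega)]
  linarith [le_of_forall_lt_succ hτ (Nat.succ_le_of_lt hli) hi]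

lemma add_le_of_lt_of_nat_mul {η x y : ℝ} (hη : 0 < η) {i j : ℕ} (hx : x = i * η) (hy : y = j * η)
    (hxy : x < y) : x + η ≤ y := by
  have h1 : i < j := by
    have : (i : ℝ) < j := lt_of_mul_lt_mul_right (hx ▸ hy ▸ hxy) hη.le
    exact_mod_cast this
  have h2 : (i + 1 : ℝ) ≤ j := by exact_mod_cast h1
  nlinarith

lemma index_le_of_mul_lt {η : ℝ} (hη : 0 < η) {i j c : ℕ}
    (hij : (i : ℝ) * η < j * η + (c + 1 : ℕ) * η) : i ≤ j + c := by
  have : (i : ℝ) < ((j + (c + 1) : ℕ) : ℝ) := by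
    push_cast at hij ⊢
    exact lt_of_mul_lt_mul_right (by linarith) hη.le
  have h2 : i < j + (c + 1) := by exact_mod_cast this
  omega


/-- The majorising estimate at the shifted times
`τ̂_ℓ = (τ_{ℓ−1} + τ_ℓ)/2` for the two interleaved grids with `q = k/m ∈ [1,2)` in
lowest terms: with `Λ₁ = {τ_ℓ ∈ 𝒯_s : τ_{ℓ−1} ∈ 𝒯_s}` and `ΔY = Y^h − Y^{h/q}`,
there is a constant `C` independent of `ℓ`, `n` and `h` such that for every
`τ_ℓ ∈ 𝒯` with `τ_{ℓ+1} ∉ Λ₁`,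
`|ΔY_{τ̂_{ℓ+1}}| ≤ C (|ΔY_{τ̂_{ℓ−1}}|·1_{τ_ℓ ∈ Λ₁} + |ΔY_{τ̂_ℓ}|·1_{τ_ℓ ∉ Λ₁} + h^{2α})`. -/
theorem stmt11 {d : ℕ} (S : RoughSetting d) (Ybar : EuclideanSpace ℝ (Fin d))
    (k m : ℕ) (hm : 0 < m) (hq1 : m ≤ k) (hq2 : k < 2 * m) (hcop : Nat.Coprime k m) :
    ∃ C : ℝ, ∀ h : ℝ, 0 < h → ∀ n : ℕ,
      ∀ Yh Yhq : ℝ → EuclideanSpace ℝ (Fin d),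
        S.IsScheme h Ybar Yh → S.IsScheme (h * m / k) Ybar Yhq →
        ∀ τ : ℕ → ℝ,
          τ 0 = ((n * m : ℕ) : ℝ) * h →
          (∀ l : ℕ, l + 1 ≤ k + m - 1 → τ l < τ (l + 1)) →
          (Finset.Icc 1 (k + m - 1)).image τ = gridTs k n (h * m / k) ∪ gridTt m n h →
          ∀ l : ℕ, 1 ≤ l → l + 1 ≤ k + m - 1 →
            ¬(τ (l + 1) ∈ gridTs k n (h * m / k) ∧ τ l ∈ gridTs k n (h * m / k)) →
            ‖Yh ((τ l + τ (l + 1)) / 2) - Yhq ((τ l + τ (l + 1)) / 2)‖ ≤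
              C * (‖Yh ((τ (l - 2) + τ (l - 1)) / 2) - Yhq ((τ (l - 2) + τ (l - 1)) / 2)‖ *
                    (if τ l ∈ gridTs k n (h * m / k) ∧ τ (l - 1) ∈ gridTs k n (h * m / k)
                      then (1 : ℝ) else 0) +
                  ‖Yh ((τ (l - 1) + τ l) / 2) - Yhq ((τ (l - 1) + τ l) / 2)‖ *
                    (if τ l ∈ gridTs k n (h * m / k) ∧ τ (l - 1) ∈ gridTs k n (h * m / k)
                      then (0 : ℝ) else 1) +
                  h ^ (2 * S.α)) := by
  obtain ⟨K, hK⟩ := S.exists_eulerRel_of_touchesCell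
  refine ⟨1 + 2 * K + 2 * S.M * K, ?_⟩
  intro h hh n Yh Yhq hYh hYhq τ hτ0 hτ himg l hl1 hlN hnot
  have hk : 0 < k := hm.trans_le hq1
  have hkR : (0 : ℝ) < k := by exact_mod_cast hk
  have hmR : (0 : ℝ) < m := by exact_mod_cast hm
  have hmk : (m : ℝ) ≤ k := by exact_mod_cast hq1
  have hkm : (k : ℝ) < 2 * m := by exact_mod_cast hq2
  set η : ℝ := h * m / k with hη_def
  have hη : 0 < η := by positivity
  have hkη : (k : ℝ) * η = m * h := by rw [hη_def]; field_simp
  have hηh : η ≤ h := by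
    rw [hη_def, div_le_iff₀ hkR]
    exact mul_le_mul_of_nonneg_left hmk hh.le
  have hhη : h < 2 * η := by
    have : (k : ℝ) * h < k * (2 * η) := by nlinarith
    exact lt_of_mul_lt_mul_left this hkR.le
  set N := k + m - 1 with hN_def
  have hends : ((n * k + k : ℕ) : ℝ) * η = ((n * m + m : ℕ) : ℝ) * h := by
    push_cast
    linear_combination ((n : ℝ) + 1) * hkη
  have hτ0' : τ 0 = ((n * k : ℕ) : ℝ) * η := by
    rw [hτ0]
    push_cast
    linear_combination -(n : ℝ) * hkη
  have hcases : ∀ l, 1 ≤ l → l ≤ N → τ l ∈ gridTs k n η ∨ τ l ∈ gridTt m n h := fun l h1 h2 =>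
    Finset.mem_union.1 (himg ▸ Finset.mem_image_of_mem τ (Finset.mem_Icc.2 ⟨h1, h2⟩))
  have hTs : ∀ x ∈ gridTs k n η, ∃ i : ℕ, i < n * k + k ∧ x = i * η := by
    intro x hx
    obtain ⟨j, hj, rfl⟩ := Finset.mem_image.1 hx
    have := Finset.mem_Icc.1 hj
    exact ⟨n * k + j, by omega, rfl⟩
  have hTt : ∀ x ∈ gridTt m n h, ∃ i : ℕ, i ≤ n * m + m ∧ x = i * h := by
    intro x hx
    obtain ⟨j, hj, rfl⟩ := Finset.mem_image.1 hx
    have := Finset.mem_Icc.1 hj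
    exact ⟨n * m + j, by omega, rfl⟩
  have hcoarse : ∀ l, l ≤ N → τ l ∉ gridTs k n η → ∃ i : ℕ, τ l = i * h := by
    intro l hl hns
    rcases Nat.eq_zero_or_pos l with rfl | hpos
    · exact ⟨_, hτ0⟩
    · obtain ⟨i, -, hi⟩ := hTt _ ((hcases l hpos hl).resolve_left hns)
      exact ⟨i, hi⟩
  have hsurj : ∀ x, x ∈ gridTs k n η ∪ gridTt m n h → ∃ l, l ≤ N ∧ τ l = x := by
    intro x hx
    obtain ⟨l, hl, rfl⟩ := Finset.mem_image.1 (himg.symm ▸ hx)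
    exact ⟨l, (Finset.mem_Icc.1 hl).2, rfl⟩
  have hmemt : ∀ i, n * m < i → i ≤ n * m + m → ∃ l, l ≤ N ∧ τ l = i * h := by
    intro i h1 h2
    refine hsurj _ (Finset.mem_union_right _ (Finset.mem_image.2
      ⟨i - n * m, Finset.mem_Icc.2 ⟨by omega, by omega⟩, ?_⟩))
    rw [Nat.add_sub_cancel' h1.le]
  have hmems : ∀ i, n * k < i → i ≤ n * k + k → ∃ l, l ≤ N ∧ τ l = i * η := by
    intro i h1 h2
    rcases h2.eq_or_lt with rfl | h3
    · rw [hends]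
      exact hmemt _ (by omega) le_rfl
    · refine hsurj _ (Finset.mem_union_left _ (Finset.mem_image.2
        ⟨i - n * k, Finset.mem_Icc.2 ⟨by omega, by omega⟩, ?_⟩))
      rw [Nat.add_sub_cancel' h1.le]
  have hub : ∀ l, l ≤ N → τ l ≤ ((n * m + m : ℕ) : ℝ) * h := by
    intro l hl
    rcases Nat.eq_zero_or_pos l with rfl | hpos
    · rw [hτ0]
      gcongr
      omega
    · rcases hcases l hpos hl with hs | ht
      · obtain ⟨i, hi, hx⟩ := hTs _ hs
        rw [hx, ← hends]
        gcongr
      · obtain ⟨i, hi, hx⟩ := hTt _ ht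
        rw [hx]
        gcongr
  have cellt : ∀ l, l + 1 ≤ N →
      ∃ j : ℕ, j * h ≤ τ l ∧ τ l < j * h + h ∧ τ (l + 1) ≤ j * h + h :=
    fun l hl => exists_cell hτ hh hτ0 hub hmemt hl
  have cells : ∀ l, l + 1 ≤ N →
      ∃ j : ℕ, j * η ≤ τ l ∧ τ l < j * η + η ∧ τ (l + 1) ≤ j * η + η :=
    fun l hl => exists_cell hτ hη hτ0' (fun l hl => hends ▸ hub l hl) hmems hl
  have touchs : ∀ l, l + 1 ≤ N → ∀ j : ℕ, j * η ≤ τ l → τ l < j * η + η →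
      τ (l + 1) ≤ j * η + η → RoughSetting.TouchesCell η j (τ l) (τ (l + 1)) := by
    intro l hl j h1 h2 h3
    have hlt := hτ l hl
    by_cases e1 : τ l = j * η
    · exact Or.inl ⟨e1, hlt, h3⟩
    by_cases e2 : τ (l + 1) = j * η + η
    · exact Or.inr ⟨e2, h1, hlt.le⟩
    exfalso
    have h1' := lt_of_le_of_ne h1 (Ne.symm e1)
    have h3' := lt_of_le_of_ne h3 e2
    have hns : ∀ x, (j : ℝ) * η < x → x < j * η + η → x ∉ gridTs k n η := by
      intro x hx1 hx2 hx
      obtain ⟨i, -, hi⟩ := hTs x hx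
      linarith [add_le_of_lt_of_nat_mul hη rfl hi hx1]
    obtain ⟨i, hi⟩ := hcoarse l (by omega) (hns _ h1' h2)
    obtain ⟨i', hi'⟩ := hcoarse (l + 1) hl (hns _ (h1'.trans hlt) h3')
    linarith [add_le_of_lt_of_nat_mul hh hi hi' hlt]
  have toucht : ∀ l, l + 1 ≤ N → ∀ j : ℕ, j * h ≤ τ l → τ (l + 1) ≤ j * h + h →
      τ l < j * h + h → ¬(τ (l + 1) ∈ gridTs k n η ∧ τ l ∈ gridTs k n η) →
      RoughSetting.TouchesCell h j (τ l) (τ (l + 1)) := by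
    intro l hl j h1 h3 h2 hno
    have hlt := hτ l hl
    by_cases hs : τ l ∈ gridTs k n η
    · obtain ⟨i, hi⟩ := hcoarse (l + 1) hl fun hs' => hno ⟨hs', hs⟩
      have := add_le_of_lt_of_nat_mul hh rfl hi (h1.trans_lt hlt)
      exact Or.inr ⟨by linarith, h1, hlt.le⟩
    · obtain ⟨i, hi⟩ := hcoarse l (by omega) hs
      rcases h1.eq_or_lt with e | h1'
      · exact Or.inl ⟨e.symm, hlt, h3⟩
      · linarith [add_le_of_lt_of_nat_mul hh rfl hi h1']
  obtain ⟨jt, jt1, jt2, jt3⟩ := cellt l hlN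
  obtain ⟨js, js1, js2, js3⟩ := cells l hlN
  have Tt := toucht l hlN jt jt1 jt3 jt2 hnot
  have Ts := touchs l hlN js js1 js2 js3
  by_cases hΛ : τ l ∈ gridTs k n η ∧ τ (l - 1) ∈ gridTs k n η
  · rw [if_pos hΛ, if_pos hΛ]
    obtain ⟨l, rfl⟩ : ∃ p, l = p + 2 := by
      refine ⟨l - 2, ?_⟩
      by_contra hcon
      obtain rfl : l = 1 := by omega
      obtain ⟨j, hj, hj'⟩ := Finset.mem_image.1 hΛ.2
      have h1 := Finset.mem_Icc.1 hj
      have h2 : ((n * k : ℕ) : ℝ) * η < ((n * k + j : ℕ) : ℝ) * η := by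
        gcongr
        omega
      simp only [Nat.sub_self] at hj'
      rw [hj', hτ0'] at h2
      exact lt_irrefl _ h2
    rw [show l + 2 - 1 = l + 1 by omega, show l + 2 - 2 = l by omega] at *
    have hlt0 := hτ l (by omega)
    have hlt1 := hτ (l + 1) (by omega)
    obtain ⟨it, it1, it2, it3⟩ := cellt l (by omega)
    obtain ⟨is, is1, is2, is3⟩ := cells l (by omega)
    obtain ⟨pt, pt1, pt2, pt3⟩ := cellt (l + 1) (by omega)
    obtain ⟨ps, ps1, ps2, ps3⟩ := cells (l + 1) (by omega)
    have Ts' := touchs l (by omega) is is1 is2 is3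
    have Tt' : RoughSetting.TouchesCell h it (τ l) (τ (l + 1)) := by
      by_cases hs : τ l ∈ gridTs k n η
      · rcases it3.eq_or_lt with e | hlt
        · exact Or.inr ⟨e, it1, hlt0.le⟩
        exfalso
        have hp : pt ≤ it := index_le_of_mul_lt (c := 0) hh (by push_cast; linarith)
        have hp' : (pt : ℝ) * h ≤ it * h := by gcongr
        obtain ⟨i₀, -, hi₀⟩ := hTs _ hs
        obtain ⟨i₁, -, hi₁⟩ := hTs _ hΛ.2
        obtain ⟨i₂, -, hi₂⟩ := hTs _ hΛ.1
        have g1 := add_le_of_lt_of_nat_mul hη hi₀ hi₁ hlt0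
        have g2 := add_le_of_lt_of_nat_mul hη hi₁ hi₂ hlt1
        linarith
      · exact toucht l (by omega) it it1 it3 it2 fun H => hs H.2
    have E := hK h h hh le_rfl Ybar Yh hYh it jt _ _ _ _
      (index_le_of_mul_lt (c := 0) hh (by push_cast; linarith))
      (index_le_of_mul_lt (c := 2) hh (by push_cast; linarith)) Tt' Tt
    have E' := hK h η hη hηh Ybar Yhq hYhq is js _ _ _ _
      (index_le_of_mul_lt (c := 0) hη (by push_cast; linarith))
      (index_le_of_mul_lt (c := 2) hη (by push_cast; linarith)) Ts' Ts
    simpa using E.norm_sub_le hh E'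
  · rw [if_neg hΛ, if_neg hΛ]
    obtain ⟨l, rfl⟩ : ∃ p, l = p + 1 := ⟨l - 1, by omega⟩
    rw [show l + 1 - 1 = l by omega] at *
    have hlt0 := hτ l (by omega)
    obtain ⟨it, it1, it2, it3⟩ := cellt l (by omega)
    obtain ⟨is, is1, is2, is3⟩ := cells l (by omega)
    have Ts' := touchs l (by omega) is is1 is2 is3
    have Tt' := toucht l (by omega) it it1 it3 it2 hΛ
    have E := hK h h hh le_rfl Ybar Yh hYh it jt _ _ _ _
      (index_le_of_mul_lt (c := 0) hh (by push_cast; linarith))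
      (index_le_of_mul_lt (c := 2) hh (by push_cast; linarith)) Tt' Tt
    have E' := hK h η hη hηh Ybar Yhq hYhq is js _ _ _ _
      (index_le_of_mul_lt (c := 0) hη (by push_cast; linarith))
      (index_le_of_mul_lt (c := 2) hη (by push_cast; linarith)) Ts' Ts
    simpa using E.norm_sub_le hh E'
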